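/- Let d be a positive integer and let J ⊊ I be squarefree monomial ideals of S such that I is generated by squarefree monomials f_1,…,f_r of degree d together with a set E of squarefree monomials of degrees ≥ d+1, and J is either 0 or generated by squarefree monomials of degrees ≥ d+1. If s > q + r, then depth_S I/J ≤ d+1. -/

import Mathlib

open MvPolynomial

/-- The squarefree monomial `∏_{i ∈ T} x_i` in `K[x_1,…,x_n]`. -/
noncomputable def sqm (K : Type*) [Field K] {n : ℕ} (T : Finset (Fin n)) :
    MvPolynomial (Fin n) K := ∏ i ∈ T, X i

/-- The poset `P_{I \ J}` of (supports of) squarefree monomials of `I \ J`. -/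
def sqPoset {K : Type*} [Field K] {n : ℕ} (I J : Ideal (MvPolynomial (Fin n) K)) :
    Set (Finset (Fin n)) :=
  {T | sqm K T ∈ I ∧ sqm K T ∉ J}

/-- The squarefree monomials of degree `k` in `I \ J`. -/
def degSet {K : Type*} [Field K] {n : ℕ} (I J : Ideal (MvPolynomial (Fin n) K)) (k : ℕ) :
    Set (Finset (Fin n)) :=
  {T ∈ sqPoset I J | T.card = k}

/-- A partition of `P_{I\J}` into intervals `[u,v]`, recorded as a finite set of
pairs `(u, v)`: each monomial of `P_{I\J}` lies in exactly one interval. -/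
def IsIntervalPartition {K : Type*} [Field K] {n : ℕ}
    (I J : Ideal (MvPolynomial (Fin n) K))
    (F : Finset (Finset (Fin n) × Finset (Fin n))) : Prop :=
  (∀ p ∈ F, p.1 ∈ sqPoset I J ∧ p.2 ∈ sqPoset I J ∧ p.1 ⊆ p.2) ∧
  (∀ T ∈ sqPoset I J, ∃! p, p ∈ F ∧ p.1 ⊆ T ∧ T ⊆ p.2)

/-- The Stanley depth of `I/J`: the maximum over interval partitions of the
minimal degree of an upper endpoint. -/
noncomputable def sdepth {K : Type*} [Field K] {n : ℕ}
    (I J : Ideal (MvPolynomial (Fin n) K)) : ℕ :=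
  sSup {k | ∃ F, IsIntervalPartition I J F ∧ ∀ p ∈ F, k ≤ p.2.card}

/-- The depth of a module over `K[x_1,…,x_n]` with respect to the maximal ideal
`(x_1,…,x_n)`: the supremum of lengths of regular sequences from `(x_1,…,x_n)`. -/
noncomputable def mdepth {K : Type*} [Field K] {n : ℕ}
    (M : Type*) [AddCommGroup M] [Module (MvPolynomial (Fin n) K) M] : ℕ :=
  sSup {k | ∃ rs : List (MvPolynomial (Fin n) K), rs.length = k ∧
    (∀ r ∈ rs, r ∈ Ideal.span (Set.range X : Set (MvPolynomial (Fin n) K))) ∧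
    RingTheory.Sequence.IsRegular M rs}

/-- The `S`-module `I/J` (more precisely `I/(J ∩ I)`). -/
abbrev quotMod {K : Type*} [Field K] {n : ℕ} (I J : Ideal (MvPolynomial (Fin n) K)) :=
  I ⧸ (Submodule.comap I.subtype J)

/-- `depth_S I/J`. -/
noncomputable def depthIJ {K : Type*} [Field K] {n : ℕ}
    (I J : Ideal (MvPolynomial (Fin n) K)) : ℕ :=
  mdepth (K := K) (n := n) (quotMod I J)

/-- An ideal is a squarefree monomial ideal generated in degrees `≥ d` if it is
the span of squarefree monomials whose supports have at least `d` elements. -/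
def SqfreeGenFrom {K : Type*} [Field K] {n : ℕ}
    (L : Ideal (MvPolynomial (Fin n) K)) (d : ℕ) : Prop :=
  ∃ G : Set (Finset (Fin n)), (∀ T ∈ G, d ≤ T.card) ∧ L = Ideal.span (sqm K '' G)

/-- A squarefree monomial ideal. -/
def IsSqfreeMonomialIdeal {K : Type*} [Field K] {n : ℕ}
    (L : Ideal (MvPolynomial (Fin n) K)) : Prop :=
  ∃ G : Set (Finset (Fin n)), L = Ideal.span (sqm K '' G)

section Koszul

variable {R ι : Type*} [CommRing R] [LinearOrder ι]

/-- The sign of `e_i ∧ -` at the basis vector indexed by `T`: the parity of the position of `i`. -/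
def koszulSign (R : Type*) [CommRing R] (i : ι) (T : Finset ι) : R :=
  (-1) ^ (T.filter (· < i)).card

theorem koszulSign_mul_self (i : ι) (T : Finset ι) :
    koszulSign R i T * koszulSign R i T = 1 := by
  rw [koszulSign, ← mul_pow]; simp

theorem koszulSign_erase_of_le {i j : ι} (h : i ≤ j) (T : Finset ι) :
    koszulSign R i (T.erase j) = koszulSign R i T := by
  rw [koszulSign, koszulSign, Finset.filter_erase, Finset.erase_eq_of_notMem]
  simp [h]

theorem koszulSign_erase_of_lt {i j : ι} (h : i < j) {T : Finset ι} (hi : i ∈ T) :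
    koszulSign R j (T.erase i) = -koszulSign R j T := by
  have hm : i ∈ T.filter (· < j) := by simp [hi, h]
  rw [koszulSign, koszulSign, Finset.filter_erase, ← Finset.card_erase_add_one hm, pow_succ]
  ring

theorem koszulSign_erase_mul_erase {i j : ι} (hij : i ≠ j) {T : Finset ι}
    (hi : i ∈ T) (hj : j ∈ T) :
    koszulSign R i (T.erase j) * koszulSign R j (T.erase i) =
      -(koszulSign R i T * koszulSign R j T) := by
  rcases lt_or_gt_of_ne hij with h | h
  · rw [koszulSign_erase_of_le h.le, koszulSign_erase_of_lt h hi]; ring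
  · rw [koszulSign_erase_of_le h.le, koszulSign_erase_of_lt h hj]; ring

theorem koszulSign_mul_erase {i j : ι} (hij : i ≠ j) {T : Finset ι} (hi : i ∈ T) (hj : j ∈ T) :
    koszulSign R i T * koszulSign R j (T.erase i) =
      -(koszulSign R j T * koszulSign R i (T.erase j)) := by
  rcases lt_or_gt_of_ne hij with h | h
  · rw [koszulSign_erase_of_le h.le, koszulSign_erase_of_lt h hi]; ring
  · rw [koszulSign_erase_of_le h.le, koszulSign_erase_of_lt h hj]; ring

variable (M : Type*) [AddCommGroup M] [Module R M]

/-- The differential of the (total) Koszul cochain complex of `x` with values in `M`; cochains of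
degree `k` are the functions supported on sets of cardinality `k`. -/
def koszulD (x : ι → R) : (Finset ι → M) →ₗ[R] (Finset ι → M) :=
  LinearMap.pi fun T => ∑ i ∈ T, (koszulSign R i T * x i) • LinearMap.proj (T.erase i)

/-- Contraction of Koszul cochains with the `j`-th basis vector. -/
def koszulContract (R : Type*) [CommRing R] [Module R M] (j : ι) :
    (Finset ι → M) →ₗ[R] (Finset ι → M) :=
  LinearMap.pi fun T =>
    if j ∈ T then 0 else koszulSign R j (insert j T) • LinearMap.proj (insert j T)

variable {M}

theorem koszulD_apply (x : ι → R) (z : Finset ι → M) (T : Finset ι) :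
    koszulD M x z T = ∑ i ∈ T, (koszulSign R i T * x i) • z (T.erase i) := by
  simp [koszulD]

theorem koszulContract_apply (j : ι) (z : Finset ι → M) (T : Finset ι) :
    koszulContract M R j z T =
      if j ∈ T then 0 else koszulSign R j (insert j T) • z (insert j T) := by
  simp only [koszulContract, LinearMap.pi_apply]
  split_ifs <;> simp

theorem koszulD_koszulD (x : ι → R) (z : Finset ι → M) : koszulD M x (koszulD M x z) = 0 := by
  ext T
  simp only [koszulD_apply, Finset.smul_sum, Pi.zero_apply]
  rw [Finset.sum_sigma']
  refine Finset.sum_involution (fun p _ => ⟨p.2, p.1⟩) ?_ ?_ ?_ ?_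
  · rintro ⟨i, j⟩ h
    simp only [Finset.mem_sigma, Finset.mem_erase] at h
    obtain ⟨hi, hji, hj⟩ := h
    dsimp only
    rw [smul_smul, smul_smul, Finset.erase_right_comm (a := j), ← add_smul]
    convert zero_smul R _ using 2
    linear_combination x i * x j * koszulSign_mul_erase (R := R) hji.symm hi hj
  · rintro ⟨i, j⟩ h _ heq
    simp only [Finset.mem_sigma, Finset.mem_erase] at h
    simp only [Sigma.mk.injEq] at heq
    exact h.2.1 heq.1
  · rintro ⟨i, j⟩ h
    simp only [Finset.mem_sigma, Finset.mem_erase] at h ⊢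
    exact ⟨h.2.2, h.2.1.symm, h.1⟩
  · rintro ⟨i, j⟩ _
    rfl

theorem koszulD_contract_add (x : ι → R) (j : ι) (z : Finset ι → M) :
    koszulD M x (koszulContract M R j z) + koszulContract M R j (koszulD M x z) = x j • z := by
  ext T
  simp only [Pi.add_apply, Pi.smul_apply, koszulContract_apply, koszulD_apply]
  by_cases hj : j ∈ T
  · rw [if_pos hj, add_zero, Finset.sum_eq_single_of_mem j hj]
    · rw [if_neg (Finset.notMem_erase j T), Finset.insert_erase hj, smul_smul]
      congr 1
      linear_combination x j * koszulSign_mul_self (R := R) j T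
    · intro i _ hij
      rw [if_pos (Finset.mem_erase.2 ⟨hij.symm, hj⟩), smul_zero]
  · rw [if_neg hj, Finset.sum_insert hj, smul_add, Finset.erase_insert hj, add_left_comm,
      smul_smul, ← mul_assoc, koszulSign_mul_self, one_mul, Finset.smul_sum,
      ← Finset.sum_add_distrib, Finset.sum_eq_zero, add_zero]
    intro i hi
    have hij : i ≠ j := fun h => hj (h ▸ hi)
    rw [if_neg (fun h => hj (Finset.mem_of_mem_erase h)),
      Finset.erase_insert_of_ne hij.symm, smul_smul, smul_smul, ← add_smul]
    convert zero_smul R _ using 2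
    have key := koszulSign_erase_mul_erase (R := R) hij (Finset.mem_insert_of_mem hi)
      (Finset.mem_insert_self j T)
    rw [Finset.erase_insert hj, Finset.erase_insert_of_ne hij.symm] at key
    linear_combination x i * key

theorem map_koszulD {N : Type*} [AddCommGroup N] [Module R N] (g : M →ₗ[R] N) (x : ι → R)
    (z : Finset ι → M) : (fun T => g (koszulD M x z T)) = koszulD N x fun T => g (z T) := by
  ext T
  simp [koszulD_apply]

/-- Multiplication by an element of the ideal generated by `x` is null-homotopic on the Koszul
complex of `x`; the homotopy lowers degrees. -/
theorem exists_smul_eq_koszulD [Fintype ι] {x : ι → R} {a : R}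
    (ha : a ∈ Ideal.span (Set.range x)) {z : Finset ι → M} (hz : koszulD M x z = 0) {k : ℕ}
    (hk : ∀ T, k + 1 ≤ T.card → z T = 0) :
    ∃ y : Finset ι → M, (∀ T, k ≤ T.card → y T = 0) ∧ koszulD M x y = a • z := by
  obtain ⟨c, rfl⟩ := Ideal.mem_span_range_iff_exists_fun.1 ha
  refine ⟨∑ j, c j • koszulContract M R j z, fun T hT => ?_, ?_⟩
  · rw [Finset.sum_apply]
    refine Finset.sum_eq_zero fun j _ => ?_
    rw [Pi.smul_apply, koszulContract_apply]
    split_ifs with hj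
    · simp
    · rw [hk _ (by rw [Finset.card_insert_of_notMem hj]; lia), smul_zero, smul_zero]
  · simp only [map_sum, map_smul, Finset.sum_smul, mul_smul]
    refine Finset.sum_congr rfl fun j _ => ?_
    rw [← koszulD_contract_add x j z, hz, map_zero, add_zero]

/-- Depth sensitivity of the Koszul complex: if the ideal generated by `x` contains a weakly
`M`-regular sequence of length `k`, then the Koszul cohomology of `M` vanishes below degree `k`. -/
theorem exists_koszulD_eq_of_isWeaklyRegular [Fintype ι] (x : ι → R) (rs : List R)
    (hrs : ∀ a ∈ rs, a ∈ Ideal.span (Set.range x)) :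
    ∀ {M : Type*} [AddCommGroup M] [Module R M], RingTheory.Sequence.IsWeaklyRegular M rs →
      ∀ z : Finset ι → M, (∀ T, rs.length ≤ T.card → z T = 0) → koszulD M x z = 0 →
        ∃ u, koszulD M x u = z := by
  induction rs with
  | nil =>
    intro M _ _ _ z hz _
    exact ⟨0, by rw [map_zero]; ext T; exact (hz T (Nat.zero_le _)).symm⟩
  | cons a rs ih =>
    intro M _ _ hreg z hz hdz
    rw [RingTheory.Sequence.isWeaklyRegular_cons_iff] at hreg
    obtain ⟨ha, hreg⟩ := hreg
    obtain ⟨y, hy, hdy⟩ := exists_smul_eq_koszulD (hrs a List.mem_cons_self) hdz hz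
    let π : M →ₗ[R] QuotSMulTop a M := Submodule.mkQ _
    have hπ : Function.Surjective π := Submodule.mkQ_surjective _
    have hker : ∀ m, π m = 0 → ∃ m', a • m' = m := fun m hm => by
      rw [Submodule.mkQ_apply, Submodule.Quotient.mk_eq_zero,
        Submodule.mem_smul_pointwise_iff_exists] at hm
      obtain ⟨m', _, h⟩ := hm
      exact ⟨m', h⟩
    have hπa : ∀ m, π (a • m) = 0 := fun m => by
      rw [Submodule.mkQ_apply, Submodule.Quotient.mk_eq_zero]
      exact Submodule.smul_mem_pointwise_smul _ _ _ trivial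
    obtain ⟨w, hw⟩ := ih (fun b hb => hrs b (List.mem_cons_of_mem _ hb)) hreg
      (fun T => π (y T)) (fun T hT => by simp [hy T hT]) (by
        rw [← map_koszulD, hdy]
        ext T
        exact hπa _)
    choose w' hw' using fun T => hπ (w T)
    have hu : ∀ T, ∃ m, a • m = y T - koszulD M x w' T := fun T => hker _ (by
      have h1 := congrFun (map_koszulD π x w') T
      simp only [hw'] at h1
      rw [map_sub, h1, hw, sub_self])
    choose u hu using hu
    refine ⟨u, ?_⟩
    have hau : a • u = y - koszulD M x w' := funext hu
    have h2 : a • koszulD M x u = a • z := by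
      rw [← map_smul, hau, map_sub, koszulD_koszulD, sub_zero, hdy]
    ext T
    exact ha (congrFun h2 T)

end Koszul

section Monomial

variable {K : Type*} [Field K] {n : ℕ}

theorem sqm_eq_monomial (T : Finset (Fin n)) :
    sqm K T = monomial (∑ i ∈ T, Finsupp.single i 1) 1 := by
  simp [sqm, X, monomial_sum_one]

theorem sum_single_apply (T : Finset (Fin n)) (i : Fin n) :
    (∑ j ∈ T, Finsupp.single j 1 : Fin n →₀ ℕ) i = if i ∈ T then 1 else 0 := by
  simp [Finsupp.finsetSum_apply, Finsupp.single_apply]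

theorem sum_single_le_iff {A T : Finset (Fin n)} :
    (∑ j ∈ A, Finsupp.single j 1 : Fin n →₀ ℕ) ≤ ∑ j ∈ T, Finsupp.single j 1 ↔ A ⊆ T := by
  rw [Finsupp.le_def]
  simp only [sum_single_apply]
  refine ⟨fun h i hi => ?_, fun h i => ?_⟩
  · by_contra hT
    have := h i
    simp [hi, hT] at this
  · by_cases hi : i ∈ A
    · simp [hi, h hi]
    · simp [hi]

/-- The coefficient of the squarefree monomial with support `T`. -/
noncomputable def sqcoeff (T : Finset (Fin n)) : MvPolynomial (Fin n) K →ₗ[K] K :=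
  lcoeff K (∑ i ∈ T, Finsupp.single i 1)

theorem sqcoeff_sqm (T : Finset (Fin n)) : sqcoeff T (sqm K T) = 1 := by
  simp [sqcoeff, sqm_eq_monomial]

theorem sqcoeff_X_mul {i : Fin n} {T : Finset (Fin n)} (hi : i ∈ T)
    (p : MvPolynomial (Fin n) K) : sqcoeff T (X i * p) = sqcoeff (T.erase i) p := by
  simp only [sqcoeff, lcoeff_apply]
  rw [← Finset.add_sum_erase T _ hi, coeff_X_mul]

theorem X_mul_sqm_erase {i : Fin n} {T : Finset (Fin n)} (hi : i ∈ T) :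
    X i * sqm K (T.erase i) = sqm K T :=
  Finset.mul_prod_erase T _ hi

theorem exists_subset_of_sqcoeff_ne_zero {G : Set (Finset (Fin n))} {p : MvPolynomial (Fin n) K}
    (hp : p ∈ Ideal.span (sqm K '' G)) {T : Finset (Fin n)} (hT : sqcoeff T p ≠ 0) :
    ∃ A ∈ G, A ⊆ T := by
  have himg : sqm K '' G = (fun m => monomial m (1 : K)) ''
      ((fun A => ∑ i ∈ A, Finsupp.single i 1) '' G) := by
    rw [Set.image_image]
    exact Set.image_congr fun A _ => sqm_eq_monomial A
  rw [himg, mem_ideal_span_monomial_image] at hp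
  obtain ⟨_, ⟨A, hA, rfl⟩, hle⟩ := hp _ (mem_support_iff.2 hT)
  exact ⟨A, hA, sum_single_le_iff.1 hle⟩

theorem sqm_mem_of_subset {L : Ideal (MvPolynomial (Fin n) K)} {A T : Finset (Fin n)}
    (h : A ⊆ T) (hA : sqm K A ∈ L) : sqm K T ∈ L :=
  L.mem_of_dvd (Finset.prod_dvd_prod_of_subset _ _ _ h) hA

theorem IsSqfreeMonomialIdeal.sqm_mem {L : Ideal (MvPolynomial (Fin n) K)}
    (hL : IsSqfreeMonomialIdeal L) {p : MvPolynomial (Fin n) K} (hp : p ∈ L)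
    {T : Finset (Fin n)} (hT : sqcoeff T p ≠ 0) : sqm K T ∈ L := by
  obtain ⟨G, rfl⟩ := hL
  obtain ⟨A, hA, hAT⟩ := exists_subset_of_sqcoeff_ne_zero hp hT
  exact sqm_mem_of_subset hAT (Ideal.subset_span ⟨A, hA, rfl⟩)

/-- The differential of the squarefree strand of the Koszul complex of `I/J`. -/
noncomputable def strandD (I J : Ideal (MvPolynomial (Fin n) K)) (k : ℕ) :
    (degSet I J k → K) →ₗ[K] (degSet I J (k + 1) → K) := by
  classical
  exact LinearMap.pi fun T => ∑ i ∈ T.1, if h : T.1.erase i ∈ degSet I J k then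
    koszulSign K i T.1 • LinearMap.proj ⟨_, h⟩ else 0

open Classical in
theorem strandD_apply (I J : Ideal (MvPolynomial (Fin n) K)) (k : ℕ) (c : degSet I J k → K)
    (T : degSet I J (k + 1)) : strandD I J k c T = ∑ i ∈ T.1,
      if h : T.1.erase i ∈ degSet I J k then koszulSign K i T.1 * c ⟨_, h⟩ else 0 := by
  simp only [strandD, LinearMap.pi_apply, LinearMap.sum_apply]
  refine Finset.sum_congr rfl fun i _ => ?_
  split_ifs <;> simp

theorem koszulSign_eq_C (i : Fin n) (T : Finset (Fin n)) :
    koszulSign (MvPolynomial (Fin n) K) i T = C (koszulSign K i T) := by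
  simp [koszulSign]

open Classical in
/-- The class of the squarefree monomial with support `T` in `I/J`, and `0` outside `I`. -/
noncomputable def sqmClass (I J : Ideal (MvPolynomial (Fin n) K)) (T : Finset (Fin n)) :
    quotMod I J :=
  if h : sqm K T ∈ I then Submodule.Quotient.mk ⟨sqm K T, h⟩ else 0

theorem sqmClass_eq_zero {I J : Ideal (MvPolynomial (Fin n) K)} {T : Finset (Fin n)}
    (hT : T ∉ sqPoset I J) : sqmClass I J T = 0 := by
  rw [sqmClass]
  split_ifs with h
  · rw [Submodule.Quotient.mk_eq_zero]
    exact not_not.1 fun hJ => hT ⟨h, hJ⟩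
  · rfl

theorem X_smul_sqmClass_erase {I J : Ideal (MvPolynomial (Fin n) K)} {T : Finset (Fin n)}
    {i : Fin n} (hi : i ∈ T) (hT : sqm K (T.erase i) ∈ I) :
    (X i : MvPolynomial (Fin n) K) • sqmClass I J (T.erase i) = sqmClass I J T := by
  rw [sqmClass, sqmClass, dif_pos hT, dif_pos (sqm_mem_of_subset (T.erase_subset i) hT),
    ← Submodule.Quotient.mk_smul]
  congr 1
  exact Subtype.ext (X_mul_sqm_erase hi)

theorem koszulD_strand (I J : Ideal (MvPolynomial (Fin n) K)) (e : Finset (Fin n) → K)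
    (he : ∀ T ∉ sqPoset I J, e T = 0) (T : Finset (Fin n)) :
    koszulD (quotMod I J) (X : Fin n → MvPolynomial (Fin n) K)
      (fun A => (C (e A) : MvPolynomial (Fin n) K) • sqmClass I J A) T =
      (C (∑ i ∈ T, koszulSign K i T * e (T.erase i)) : MvPolynomial (Fin n) K) •
        sqmClass I J T := by
  rw [koszulD_apply, map_sum, Finset.sum_smul]
  refine Finset.sum_congr rfl fun i hi => ?_
  by_cases h : T.erase i ∈ sqPoset I J
  · rw [← X_smul_sqmClass_erase hi h.1, smul_smul, smul_smul, koszulSign_eq_C, C_mul]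
    congr 1
    ring
  · simp [he _ h]

/-- If `I/J` admits a weakly regular sequence of length at least `k + 2` in the maximal ideal, then
the squarefree strand of its Koszul complex is exact in degree `k + 1`. -/
theorem exists_strandD_eq {I J : Ideal (MvPolynomial (Fin n) K)} (hI : IsSqfreeMonomialIdeal I)
    (hJ : IsSqfreeMonomialIdeal J) {rs : List (MvPolynomial (Fin n) K)}
    (hrs : ∀ r ∈ rs, r ∈ Ideal.span (Set.range X : Set (MvPolynomial (Fin n) K)))
    (hreg : RingTheory.Sequence.IsWeaklyRegular (quotMod I J) rs) {k : ℕ}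
    (hk : k + 2 ≤ rs.length) {c : degSet I J (k + 1) → K} (hc : strandD I J (k + 1) c = 0) :
    ∃ b, strandD I J k b = c := by
  classical
  let e : Finset (Fin n) → K := fun T => if h : T ∈ degSet I J (k + 1) then c ⟨T, h⟩ else 0
  have he : ∀ T ∉ degSet I J (k + 1), e T = 0 := fun T hT => dif_neg hT
  obtain ⟨u, hu⟩ := exists_koszulD_eq_of_isWeaklyRegular X rs hrs hreg
    (fun A => (C (e A) : MvPolynomial (Fin n) K) • sqmClass I J A)
    (fun T hT => by
      rw [he T (fun h => by have := h.2; lia), map_zero, zero_smul])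
    (by
      ext T
      rw [koszulD_strand I J e (fun T hT => he T fun h => hT h.1), Pi.zero_apply]
      by_cases hT : T ∈ sqPoset I J
      · by_cases hcard : T.card = k + 1 + 1
        · have := congrFun hc ⟨T, hT, hcard⟩
          rw [strandD_apply] at this
          suffices hsum : ∑ i ∈ T, koszulSign K i T * e (T.erase i) = 0 by
            rw [hsum, map_zero, zero_smul]
          refine Eq.trans ?_ this
          refine Finset.sum_congr rfl fun i _ => ?_
          simp only [e]
          split_ifs <;> simp
        · rw [Finset.sum_eq_zero, map_zero, zero_smul]
          intro i hi
          rw [he, mul_zero]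
          rintro ⟨_, h⟩
          rw [Finset.card_erase_of_mem hi] at h
          lia
      · rw [sqmClass_eq_zero hT, smul_zero])
  choose v hv using fun T => Submodule.Quotient.mk_surjective _ (u T)
  refine ⟨fun T => sqcoeff T.1 (v T.1 : MvPolynomial (Fin n) K), ?_⟩
  ext ⟨T, hT⟩
  have hmem : (∑ i ∈ T, (koszulSign (MvPolynomial (Fin n) K) i T * X i) * (v (T.erase i)).1) -
      C (c ⟨T, hT⟩) * sqm K T ∈ J := by
    have h := congrFun hu T
    simp only [koszulD_apply, ← hv, e, dif_pos hT, sqmClass, dif_pos hT.1.1,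
      ← Submodule.Quotient.mk_smul] at h
    rw [← Submodule.mkQ_apply, ← sub_eq_zero] at h
    simp only [← Submodule.mkQ_apply] at h
    rw [← map_sum, ← map_sub, Submodule.mkQ_apply, Submodule.Quotient.mk_eq_zero] at h
    simpa using h
  have hzero := not_not.1 fun h => hT.1.2 (hJ.sqm_mem hmem (T := T) h)
  rw [map_sub, sub_eq_zero, C_mul', map_smul, sqcoeff_sqm, smul_eq_mul, mul_one] at hzero
  rw [strandD_apply, ← hzero, map_sum]
  refine Finset.sum_congr rfl fun i hi => ?_
  rw [koszulSign_eq_C, mul_assoc, C_mul', map_smul, sqcoeff_X_mul hi, smul_eq_mul]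
  split_ifs with h
  · rfl
  · rw [eq_comm, mul_eq_zero]
    right
    by_contra hne
    refine h ⟨⟨hI.sqm_mem (v _).2 hne, fun hmemJ =>
      hT.1.2 (sqm_mem_of_subset (T.erase_subset i) hmemJ)⟩, ?_⟩
    rw [Finset.card_erase_of_mem hi, hT.2, Nat.add_sub_cancel]

theorem ncard_degSet_le {I J : Ideal (MvPolynomial (Fin n) K)} (hI : IsSqfreeMonomialIdeal I)
    (hJ : IsSqfreeMonomialIdeal J) {rs : List (MvPolynomial (Fin n) K)}
    (hrs : ∀ r ∈ rs, r ∈ Ideal.span (Set.range X : Set (MvPolynomial (Fin n) K)))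
    (hreg : RingTheory.Sequence.IsWeaklyRegular (quotMod I J) rs) {k : ℕ}
    (hk : k + 2 ≤ rs.length) :
    (degSet I J (k + 1)).ncard ≤ (degSet I J (k + 2)).ncard + (degSet I J k).ncard := by
  classical
  have hdim : ∀ m, Module.finrank K (degSet I J m → K) = (degSet I J m).ncard := fun m => by
    rw [Module.finrank_pi, ← Nat.card_eq_fintype_card, Nat.card_coe_set_eq]
  have hle : LinearMap.ker (strandD I J (k + 1)) ≤ LinearMap.range (strandD I J k) :=
    fun c hc => exists_strandD_eq hI hJ hrs hreg hk hc
  have h1 := (strandD I J (k + 1)).finrank_range_add_finrank_ker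
  have h2 := Submodule.finrank_mono hle
  have h3 := LinearMap.finrank_range_le (strandD I J k)
  have h4 := Submodule.finrank_le (LinearMap.range (strandD I J (k + 1)))
  rw [hdim] at h1 h3 h4
  lia

theorem ncard_degSet_le_of_span {d r : ℕ} {I J : Ideal (MvPolynomial (Fin n) K)}
    {f : Fin r → Finset (Fin n)} (hfd : ∀ i, (f i).card = d)
    {E : Set (Finset (Fin n))} (hE : ∀ T ∈ E, d + 1 ≤ T.card)
    (hI : I = Ideal.span (sqm K '' (Set.range f ∪ E))) : (degSet I J d).ncard ≤ r := by
  have hsub : degSet I J d ⊆ Set.range f := by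
    rintro T ⟨⟨hTI, _⟩, hcard⟩
    rw [hI] at hTI
    obtain ⟨A, hA, hAT⟩ := exists_subset_of_sqcoeff_ne_zero hTI (T := T) (by simp [sqcoeff_sqm])
    have hle := Finset.card_le_card hAT
    rcases hA with ⟨i, rfl⟩ | hA
    · exact ⟨i, Finset.eq_of_subset_of_card_le hAT (by rw [hcard, hfd])⟩
    · have := hE A hA
      lia
  calc (degSet I J d).ncard ≤ (Set.range f).ncard := Set.ncard_le_ncard hsub (Set.toFinite _)
    _ ≤ (Set.univ : Set (Fin r)).ncard := by
      rw [← Set.image_univ]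
      exact Set.ncard_image_le (Set.toFinite _)
    _ = r := by simp [Set.ncard_univ]

end Monomial

/-- if `s > q + r` then `depth I/J ≤ d + 1`. -/
theorem statement10 {K : Type*} [Field K] {n : ℕ} (d : ℕ) (hd : 0 < d) (r : ℕ)
    (I J : Ideal (MvPolynomial (Fin n) K)) (hJI : J < I)
    (f : Fin r → Finset (Fin n)) (hfd : ∀ i, (f i).card = d)
    (E : Set (Finset (Fin n))) (hE : ∀ T ∈ E, d + 1 ≤ T.card)
    (hI : I = Ideal.span (sqm K '' (Set.range f ∪ E)))
    (hJ : SqfreeGenFrom J (d + 1))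
    (hsq : (degSet I J (d + 2)).ncard + r < (degSet I J (d + 1)).ncard) :
    depthIJ I J ≤ d + 1 := by
  refine csSup_le' ?_
  rintro _ ⟨rs, rfl, hrs, hreg⟩
  by_contra! hlt
  obtain ⟨G, -, hG⟩ := hJ
  have h1 := ncard_degSet_le ⟨_, hI⟩ ⟨G, hG⟩ hrs hreg.toIsWeaklyRegular (k := d) hlt
  have h2 := ncard_degSet_le_of_span (J := J) hfd hE hI
  lia
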